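/- arXiv:1003.3714 — 10 statements merged into one kernel-verified Lean document; each statement's English description precedes it below -/
import Mathlib

section
/- For all a, b in ℝ: (deriv (φ a) b) * ψ_r b = ψ_r (φ a b); that is, the partial derivative of the group operation in its second argument satisfies ∂φ(a,b)/∂b = ψ_r(φ a b)/ψ_r(b) whenever ψ_r b ≠ 0. -/
/-- The operation of a 1-parameter Lie group satisfies the differential equation
`∂φ(a,b)/∂b · ψ_r(b) = ψ_r(φ a b)`, i.e. `∂φ(a,b)/∂b = ψ_r(φ a b)/ψ_r(b)` when `ψ_r b ≠ 0`. -/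
theorem one_parameter_group_differential_equation
    (φ : ℝ → ℝ → ℝ) (hφ : ContDiff ℝ (⊤ : ℕ∞) (Function.uncurry φ))
    (hassoc : ∀ a b c : ℝ, φ (φ a b) c = φ a (φ b c))
    (e : ℝ) (hre : ∀ a : ℝ, φ a e = a) (hle : ∀ b : ℝ, φ e b = b)
    (ψr : ℝ → ℝ) (hψr : ∀ a : ℝ, ψr a = deriv (φ a) e) :
    ∀ a b : ℝ, deriv (φ a) b * ψr b = ψr (φ a b) := by
  intro a b
  have hdiff : ∀ x, Differentiable ℝ (φ x) := fun x =>
    (hφ.comp (contDiff_const.prodMk contDiff_id)).differentiable (by simp)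
  have hcomp : φ (φ a b) = φ a ∘ φ b := funext (hassoc a b)
  rw [hψr, hψr, hcomp, deriv_comp e (hdiff a _) (hdiff b e), hre]
end

section
/- Assume moreover that ψ_r a ≠ 0 for every a, and define F a := ∫ t in e..a, (ψ_r t)⁻¹ (interval integral). Then F transforms the group operation into addition: F (φ a b) = F a + F b for all a, b in ℝ, and F e = 0. -/
/-- The partial derivative of a smooth function of two variables in the second variable, as a
value of its Fréchet derivative. -/
theorem hasDerivAt_snd_of_contDiff {φ : ℝ → ℝ → ℝ}
    (hφ : ContDiff ℝ (⊤ : ℕ∞) (Function.uncurry φ)) (a b : ℝ) :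
    HasDerivAt (φ a) (fderiv ℝ (Function.uncurry φ) (a, b) (0, 1)) b := by
  have h : HasFDerivAt (Function.uncurry φ) (fderiv ℝ (Function.uncurry φ) (a, b)) (a, b) :=
    ((hφ.differentiable (by simp)) (a, b)).hasFDerivAt
  exact h.comp_hasDerivAt b ((hasDerivAt_const b a).prodMk (hasDerivAt_id b))

/-- The partial derivative of a smooth function of two variables in the second variable is
continuous in the first variable. -/
theorem continuous_deriv_snd_of_contDiff {φ : ℝ → ℝ → ℝ}
    (hφ : ContDiff ℝ (⊤ : ℕ∞) (Function.uncurry φ)) (e : ℝ) :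
    Continuous fun a => deriv (φ a) e := by
  have hc : Continuous (fderiv ℝ (Function.uncurry φ)) := hφ.continuous_fderiv (by simp)
  simp_rw [fun a => (hasDerivAt_snd_of_contDiff hφ a e).deriv]
  exact (hc.comp (by fun_prop : Continuous fun a : ℝ => (a, e))).clm_apply continuous_const

/-- The basic function of an associative operation with right identity `e` is
invariant under left translations. -/
theorem deriv_mul_deriv_eq_of_assoc {φ : ℝ → ℝ → ℝ} (hφ : ∀ a, Differentiable ℝ (φ a))
    (hassoc : ∀ a b c : ℝ, φ (φ a b) c = φ a (φ b c)) {e : ℝ} (hre : ∀ a : ℝ, φ a e = a)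
    (a b : ℝ) : deriv (φ (φ a b)) e = deriv (φ a) b * deriv (φ b) e := by
  have hcomp : φ (φ a b) = φ a ∘ φ b := funext (hassoc a b)
  rw [hcomp, deriv_comp e (hφ a _) (hφ b e), hre]

/-- On a 1-parameter Lie group, the coordinate `F a = ∫ t in e..a, 1/ψ_r t` transforms the group
operation into addition and sends the identity to `0`. -/
theorem one_parameter_group_canonical_coordinate
    (φ : ℝ → ℝ → ℝ) (hφ : ContDiff ℝ (⊤ : ℕ∞) (Function.uncurry φ))
    (hassoc : ∀ a b c : ℝ, φ (φ a b) c = φ a (φ b c))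
    (e : ℝ) (hre : ∀ a : ℝ, φ a e = a) (hle : ∀ b : ℝ, φ e b = b)
    (ψr : ℝ → ℝ) (hψr : ∀ a : ℝ, ψr a = deriv (φ a) e)
    (hne : ∀ a : ℝ, ψr a ≠ 0)
    (F : ℝ → ℝ) (hF : ∀ a : ℝ, F a = ∫ t in e..a, (ψr t)⁻¹) :
    (∀ a b : ℝ, F (φ a b) = F a + F b) ∧ F e = 0 := by
  have hFe : F e = 0 := by simp [hF]
  refine ⟨fun a b => ?_, hFe⟩
  have hd : ∀ x, Differentiable ℝ (φ x) := fun x y =>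
    (hasDerivAt_snd_of_contDiff hφ x y).differentiableAt
  have hcont : Continuous fun t => (ψr t)⁻¹ :=
    (funext hψr ▸ continuous_deriv_snd_of_contDiff hφ e : Continuous ψr).inv₀ hne
  have hF' : ∀ x, HasDerivAt F (ψr x)⁻¹ x := fun x =>
    funext hF ▸ hcont.integral_hasStrictDerivAt e x |>.hasDerivAt
  have hG : ∀ x, HasDerivAt (fun y => F (φ a y) - F y) 0 x := fun x => by
    have hmul : ψr (φ a x) = deriv (φ a) x * ψr x := by
      simpa only [hψr] using deriv_mul_deriv_eq_of_assoc hd hassoc hre a x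
    have hne' : deriv (φ a) x ≠ 0 := left_ne_zero_of_mul (hmul ▸ hne (φ a x))
    have hx := hne x
    refine (((hF' (φ a x)).comp x (hd a x).hasDerivAt).sub (hF' x)).congr_deriv ?_
    rw [hmul]
    field_simp
    ring
  have := is_const_of_deriv_eq_zero (fun x => (hG x).differentiableAt) (fun x => (hG x).deriv) b e
  simp only [hre, hFe] at this
  linarith
end

section
/- The right structure constants are independent of the point of the group: for all a, u, v in ℝⁿ, (fderiv ℝ λ_r a (ψ_r a u)) (ψ_r a v) - (fderiv ℝ λ_r a (ψ_r a v)) (ψ_r a u) = (fderiv ℝ λ_r e u) v - (fderiv ℝ λ_r e v) u, where λ_r : ℝⁿ → (ℝⁿ →L[ℝ] ℝⁿ) is the map a ↦ λ_r a. -/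
/-- The second derivative of a smooth map cancels from the antisymmetrised derivative of the
pullback of a vector-valued one-form. -/
theorem fderiv_pullback_antisymm {E F G : Type*} [NormedAddCommGroup E] [NormedSpace ℝ E]
    [NormedAddCommGroup F] [NormedSpace ℝ F] [NormedAddCommGroup G] [NormedSpace ℝ G]
    {L : E → F} {ω : F → F →L[ℝ] G} {x : E} (hL : ContDiffAt ℝ 2 L x)
    (hω : DifferentiableAt ℝ ω (L x)) (u v : E) :
    fderiv ℝ (fun y => (ω (L y)).comp (fderiv ℝ L y)) x u v
        - fderiv ℝ (fun y => (ω (L y)).comp (fderiv ℝ L y)) x v u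
      = fderiv ℝ ω (L x) (fderiv ℝ L x u) (fderiv ℝ L x v)
        - fderiv ℝ ω (L x) (fderiv ℝ L x v) (fderiv ℝ L x u) := by
  have hL1 : DifferentiableAt ℝ L x := hL.differentiableAt (by norm_num)
  have hL2 : DifferentiableAt ℝ (fderiv ℝ L) x :=
    (hL.fderiv_right (m := 1) (by norm_num)).differentiableAt (by norm_num)
  have hsymm : fderiv ℝ (fderiv ℝ L) x u v = fderiv ℝ (fderiv ℝ L) x v u :=
    (hL.isSymmSndFDerivAt (by simp)).eq u v
  have hD := ((hω.hasFDerivAt.comp x hL1.hasFDerivAt).clm_comp hL2.hasFDerivAt).fderiv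
  simp only [Function.comp_apply] at hD
  rw [hD]
  simp [hsymm]

/-- The pointwise inverse of a differentiable family of operators is differentiable. -/
theorem differentiable_of_mul_eq_one {E R : Type*} [NormedAddCommGroup E] [NormedSpace ℝ E]
    [NormedRing R] [NormedAlgebra ℝ R] [HasSummableGeomSeries R] {f g : E → R}
    (hf : Differentiable ℝ f) (hgf : ∀ x, g x * f x = 1) (hfg : ∀ x, f x * g x = 1) :
    Differentiable ℝ g := by
  let U : E → Rˣ := fun x => ⟨f x, g x, hfg x, hgf x⟩
  have hg : g = fun x => Ring.inverse (f x) := funext fun x => (Ring.inverse_unit (U x)).symm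
  rw [hg]
  exact fun x => (differentiableAt_inverse (𝕜 := ℝ) (U x).isUnit).comp x (hf x)

/-- The right structure constants of a Lie group structure on `ℝⁿ` do not depend on the point of
the group. -/
theorem right_structure_constants_independent_of_point {n : ℕ}
    (φ : EuclideanSpace ℝ (Fin n) → EuclideanSpace ℝ (Fin n) → EuclideanSpace ℝ (Fin n))
    (hφ : ContDiff ℝ (⊤ : ℕ∞) (Function.uncurry φ))
    (e : EuclideanSpace ℝ (Fin n)) (ι : EuclideanSpace ℝ (Fin n) → EuclideanSpace ℝ (Fin n))
    (hι : ContDiff ℝ (⊤ : ℕ∞) ι)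
    (hassoc : ∀ a b c, φ (φ a b) c = φ a (φ b c))
    (hre : ∀ a, φ a e = a) (hle : ∀ a, φ e a = a)
    (hinvr : ∀ a, φ a (ι a) = e) (hinvl : ∀ a, φ (ι a) a = e)
    (ψr : EuclideanSpace ℝ (Fin n) →
      (EuclideanSpace ℝ (Fin n) →L[ℝ] EuclideanSpace ℝ (Fin n)))
    (hψr : ∀ a, ψr a = fderiv ℝ (fun x => φ a x) e)
    (lr : EuclideanSpace ℝ (Fin n) →
      (EuclideanSpace ℝ (Fin n) →L[ℝ] EuclideanSpace ℝ (Fin n)))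
    (hlr : ∀ a, (lr a).comp (ψr a) = ContinuousLinearMap.id ℝ (EuclideanSpace ℝ (Fin n)) ∧
      (ψr a).comp (lr a) = ContinuousLinearMap.id ℝ (EuclideanSpace ℝ (Fin n))) :
    ∀ a u v : EuclideanSpace ℝ (Fin n),
      (fderiv ℝ lr a (ψr a u)) (ψr a v) - (fderiv ℝ lr a (ψr a v)) (ψr a u)
        = (fderiv ℝ lr e u) v - (fderiv ℝ lr e v) u := by
  intro a u v
  have hL (b) : ContDiff ℝ (⊤ : ℕ∞) (φ b) := hφ.comp (contDiff_const.prodMk contDiff_id)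
  have hLd (b) : Differentiable ℝ (φ b) := (hL b).differentiable (by simp)
  have hψ : ψr = fun b => fderiv ℝ (φ b) e := funext hψr
  have hψd : Differentiable ℝ ψr := by
    rw [hψ]
    exact (ContDiff.fderiv (m := (⊤ : ℕ∞)) (n := 1) hφ contDiff_const
      (by norm_num; exact WithTop.coe_le_coe.2 le_top)).differentiable (by norm_num)
  have hld : Differentiable ℝ lr :=
    differentiable_of_mul_eq_one hψd (fun b => (hlr b).1) (fun b => (hlr b).2)
  have hψ_mul (b) : ψr (φ a b) = (fderiv ℝ (φ a) b).comp (ψr b) := by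
    have hcomp : φ (φ a b) = φ a ∘ φ b := funext (hassoc a b)
    simp only [hψ]
    rw [hcomp, fderiv_comp e (hLd a _) (hLd b _), hre]
  have hl_mul : (fun b => (lr (φ a b)).comp (fderiv ℝ (φ a) b)) = lr := by
    funext b
    calc (lr (φ a b)).comp (fderiv ℝ (φ a) b)
        = ((lr (φ a b)).comp (fderiv ℝ (φ a) b)).comp ((ψr b).comp (lr b)) := by
          rw [(hlr b).2, ContinuousLinearMap.comp_id]
      _ = ((lr (φ a b)).comp (ψr (φ a b))).comp (lr b) := by
          rw [hψ_mul]; rfl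
      _ = lr b := by rw [(hlr _).1, ContinuousLinearMap.id_comp]
  have h := fderiv_pullback_antisymm (ω := lr)
    ((hL a).contDiffAt.of_le (WithTop.coe_le_coe.2 le_top) : ContDiffAt ℝ 2 (φ a) e) (hld _) u v
  rw [hl_mul, hre] at h
  rw [hψr a]
  exact h.symm
end

section
/- The Lie bracket of two right-invariant vector fields is again right-invariant: for all u, v, a in ℝⁿ, VectorField.lieBracket ℝ (fun x => ψ_r x u) (fun x => ψ_r x v) a = ψ_r a (VectorField.lieBracket ℝ (fun x => ψ_r x u) (fun x => ψ_r x v) e). -/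
/-- If a `C²` map `f` carries the vector fields `V` and `W` to `V'` and `W'` respectively, it carries
their Lie bracket to the Lie bracket of `V'` and `W'`. -/
theorem fderiv_lieBracket_of_related {E F : Type*} [NormedAddCommGroup E] [NormedSpace ℝ E]
    [NormedAddCommGroup F] [NormedSpace ℝ F] {f : E → F} {V W : E → E} {V' W' : F → F} {x : E}
    (hf : ContDiffAt ℝ 2 f x) (hV : DifferentiableAt ℝ V x) (hW : DifferentiableAt ℝ W x)
    (hV' : DifferentiableAt ℝ V' (f x)) (hW' : DifferentiableAt ℝ W' (f x))
    (hfV : ∀ y, fderiv ℝ f y (V y) = V' (f y)) (hfW : ∀ y, fderiv ℝ f y (W y) = W' (f y)) :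
    fderiv ℝ f x (VectorField.lieBracket ℝ V W x) = VectorField.lieBracket ℝ V' W' (f x) := by
  have hfx : DifferentiableAt ℝ f x := hf.differentiableAt (by norm_num)
  rw [VectorField.fderiv_apply_lieBracket hf (by simp) hW hV]
  simp only [hfV, hfW, VectorField.lieBracket]
  rw [fderiv_fun_comp x hW' hfx, fderiv_fun_comp x hV' hfx]
  simp [hfV, hfW]

/-- The Lie bracket of two right-invariant vector fields is again right-invariant. -/
theorem lieBracket_right_invariant {n : ℕ}
    (φ : EuclideanSpace ℝ (Fin n) → EuclideanSpace ℝ (Fin n) → EuclideanSpace ℝ (Fin n))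
    (hφ : ContDiff ℝ (⊤ : ℕ∞) (Function.uncurry φ))
    (e : EuclideanSpace ℝ (Fin n)) (ι : EuclideanSpace ℝ (Fin n) → EuclideanSpace ℝ (Fin n))
    (hι : ContDiff ℝ (⊤ : ℕ∞) ι)
    (hassoc : ∀ a b c, φ (φ a b) c = φ a (φ b c))
    (hre : ∀ a, φ a e = a) (hle : ∀ a, φ e a = a)
    (hinvr : ∀ a, φ a (ι a) = e) (hinvl : ∀ a, φ (ι a) a = e)
    (ψr : EuclideanSpace ℝ (Fin n) →
      (EuclideanSpace ℝ (Fin n) →L[ℝ] EuclideanSpace ℝ (Fin n)))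
    (hψr : ∀ a, ψr a = fderiv ℝ (fun x => φ a x) e)
    (hunit : ∀ a, IsUnit (ψr a)) :
    ∀ u v a : EuclideanSpace ℝ (Fin n),
      VectorField.lieBracket ℝ (fun x => ψr x u) (fun x => ψr x v) a
        = ψr a (VectorField.lieBracket ℝ (fun x => ψr x u) (fun x => ψr x v) e) := by
  intro u v a
  have hleft (b) : ContDiff ℝ (⊤ : ℕ∞) (φ b) := hφ.comp (contDiff_prodMk_right b)
  have hdiff (b) : Differentiable ℝ (φ b) := (hleft b).differentiable (by simp)
  have hfield (w) : Differentiable ℝ (fun x => ψr x w) := by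
    have h : ContDiff ℝ 1 (fun x => fderiv ℝ (φ x) e) :=
      ContDiff.fderiv (m := 2) (hφ.of_le (WithTop.coe_le_coe.2 (le_top : (2 : ℕ∞) ≤ ⊤))) contDiff_const
        (by norm_num)
    simp only [hψr]
    exact (h.clm_apply contDiff_const).differentiable (by simp)
  have hrelated (w x) : fderiv ℝ (φ a) x (ψr x w) = ψr (φ a x) w := by
    have hcomp : φ (φ a x) = φ a ∘ φ x := funext (hassoc a x)
    simp only [hψr]
    rw [hcomp, fderiv_comp e (by exact hdiff a _) (hdiff x e), hre]
    rfl
  have h := fderiv_lieBracket_of_related (f := φ a) (x := e)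
    ((hleft a).contDiffAt.of_le (WithTop.coe_le_coe.2 (le_top : (2 : ℕ∞) ≤ ⊤)))
    (hfield u e) (hfield v e) (hfield u _) (hfield v _) (hrelated u) (hrelated v)
  rw [hre] at h
  rw [← h, hψr]
end

section
/- The Lie bracket of two left-invariant vector fields is again left-invariant: for all u, v, a in ℝⁿ, VectorField.lieBracket ℝ (fun x => ψ_l x u) (fun x => ψ_l x v) a = ψ_l a (VectorField.lieBracket ℝ (fun x => ψ_l x u) (fun x => ψ_l x v) e). -/
open VectorField in
/-- The Lie bracket is natural: it sends pairs of `f`-related vector fields to `f`-related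
vector fields. -/
theorem lieBracket_apply_of_fderiv_related {E F : Type*} [NormedAddCommGroup E] [NormedSpace ℝ E]
    [NormedAddCommGroup F] [NormedSpace ℝ F] {f : E → F} {V W : E → E} {V' W' : F → F} {x : E}
    (hf : ContDiffAt ℝ 2 f x) (hV : DifferentiableAt ℝ V x) (hW : DifferentiableAt ℝ W x)
    (hV' : DifferentiableAt ℝ V' (f x)) (hW' : DifferentiableAt ℝ W' (f x))
    (hVV' : ∀ y, V' (f y) = fderiv ℝ f y (V y)) (hWW' : ∀ y, W' (f y) = fderiv ℝ f y (W y)) :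
    lieBracket ℝ V' W' (f x) = fderiv ℝ f x (lieBracket ℝ V W x) := by
  have hf1 : DifferentiableAt ℝ f x := hf.differentiableAt (by norm_num)
  have hf2 : DifferentiableAt ℝ (fderiv ℝ f) x :=
    (hf.fderiv_right (m := 1) (by norm_num)).differentiableAt (by norm_num)
  have key {X : E → E} {X' : F → F} (hX : DifferentiableAt ℝ X x)
      (hX' : DifferentiableAt ℝ X' (f x)) (h : ∀ y, X' (f y) = fderiv ℝ f y (X y)) (v : E) :
      fderiv ℝ X' (f x) (fderiv ℝ f x v)
        = fderiv ℝ f x (fderiv ℝ X x v) + fderiv ℝ (fderiv ℝ f) x v (X x) := by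
    have hcomp : X' ∘ f = fun y => fderiv ℝ f y (X y) := funext h
    have := congrArg (fun g => fderiv ℝ g x v) hcomp
    simpa [fderiv_comp x hX' hf1, fderiv_clm_apply hf2 hX] using this
  have hsymm : fderiv ℝ (fderiv ℝ f) x (V x) (W x) = fderiv ℝ (fderiv ℝ f) x (W x) (V x) :=
    (hf.isSymmSndFDerivAt (by simp)) (V x) (W x)
  simp only [lieBracket_eq, hVV', hWW', key hV hV' hVV', key hW hW' hWW', map_sub, hsymm]
  abel


/-- The Lie bracket of two left-invariant vector fields is again left-invariant. -/
theorem lieBracket_left_invariant {n : ℕ}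
    (φ : EuclideanSpace ℝ (Fin n) → EuclideanSpace ℝ (Fin n) → EuclideanSpace ℝ (Fin n))
    (hφ : ContDiff ℝ (⊤ : ℕ∞) (Function.uncurry φ))
    (e : EuclideanSpace ℝ (Fin n)) (ι : EuclideanSpace ℝ (Fin n) → EuclideanSpace ℝ (Fin n))
    (hι : ContDiff ℝ (⊤ : ℕ∞) ι)
    (hassoc : ∀ a b c, φ (φ a b) c = φ a (φ b c))
    (hre : ∀ a, φ a e = a) (hle : ∀ a, φ e a = a)
    (hinvr : ∀ a, φ a (ι a) = e) (hinvl : ∀ a, φ (ι a) a = e)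
    (ψl : EuclideanSpace ℝ (Fin n) →
      (EuclideanSpace ℝ (Fin n) →L[ℝ] EuclideanSpace ℝ (Fin n)))
    (hψl : ∀ a, ψl a = fderiv ℝ (fun x => φ x a) e)
    (hunit : ∀ a, IsUnit (ψl a)) :
    ∀ u v a : EuclideanSpace ℝ (Fin n),
      VectorField.lieBracket ℝ (fun x => ψl x u) (fun x => ψl x v) a
        = ψl a (VectorField.lieBracket ℝ (fun x => ψl x u) (fun x => ψl x v) e) := by
  intro u v a
  have htrans (b) : ContDiff ℝ (⊤ : ℕ∞) (fun x => φ x b) :=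
    hφ.comp (contDiff_id.prodMk contDiff_const)
  have hψ (w) : Differentiable ℝ (fun x => ψl x w) := by
    have hψ_smooth : ContDiff ℝ (⊤ : ℕ∞) (fun x => fderiv ℝ (fun y => φ y x) e) :=
      ContDiff.fderiv (f := fun x y => φ y x) (n := (⊤ : ℕ∞))
        (hφ.comp (contDiff_snd.prodMk contDiff_fst)) contDiff_const (by simp)
    simp only [hψl]
    exact (hψ_smooth.differentiable (by simp)).clm_apply (differentiable_const w)
  have hrel (w y) : ψl (φ y a) w = fderiv ℝ (fun x => φ x a) y (ψl y w) := by
    have hcomp : (fun x => φ x (φ y a)) = (fun x => φ x a) ∘ (fun x => φ x y) :=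
      funext fun x => (hassoc x y a).symm
    rw [hψl, hψl, hcomp, fderiv_comp e ((htrans a).differentiable (by simp) _)
      ((htrans y).differentiable (by simp) _), hle]
    rfl
  have hbracket := lieBracket_apply_of_fderiv_related (f := fun x => φ x a) (x := e)
    ((htrans a).contDiffAt.of_le (WithTop.coe_le_coe.2 le_top)) (hψ u e) (hψ v e) (hψ u _) (hψ v _)
    (hrel u) (hrel v)
  rwa [hle, ← hψl] at hbracket
end

section
/- The right-defined and left-defined Lie algebra structures on the tangent space at the identity are opposite to each other: for all u, v in ℝⁿ, VectorField.lieBracket ℝ (fun x => ψ_r x u) (fun x => ψ_r x v) e = - VectorField.lieBracket ℝ (fun x => ψ_l x u) (fun x => ψ_l x v) e. -/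
section PartialDerivatives

variable {𝕜 E F G : Type*} [NontriviallyNormedField 𝕜] [NormedAddCommGroup E] [NormedSpace 𝕜 E]
  [NormedAddCommGroup F] [NormedSpace 𝕜 F] [NormedAddCommGroup G] [NormedSpace 𝕜 G]

theorem fderiv_comp_prodMk_right_apply {f : E × F → G} {a : E} {b : F}
    (hf : DifferentiableAt 𝕜 f (a, b)) (v : F) :
    fderiv 𝕜 (fun x => f (a, x)) b v = fderiv 𝕜 f (a, b) (0, v) := by
  have h := (hf.hasFDerivAt.comp b (hasFDerivAt_prodMk_right a b)).fderiv
  simp only [Function.comp_def] at h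
  simp [h]

theorem fderiv_comp_prodMk_left_apply {f : E × F → G} {a : E} {b : F}
    (hf : DifferentiableAt 𝕜 f (a, b)) (v : E) :
    fderiv 𝕜 (fun x => f (x, b)) a v = fderiv 𝕜 f (a, b) (v, 0) := by
  have h := (HasFDerivAt.comp (f := fun x => (x, b)) a hf.hasFDerivAt
    (hasFDerivAt_prodMk_left a b)).fderiv
  simp only [Function.comp_def] at h
  simp [h]

end PartialDerivatives

/-- The right-defined and left-defined Lie algebra structures on the tangent space at the
identity are opposite to each other. -/
theorem right_and_left_lie_algebras_opposite {n : ℕ}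
    (φ : EuclideanSpace ℝ (Fin n) → EuclideanSpace ℝ (Fin n) → EuclideanSpace ℝ (Fin n))
    (hφ : ContDiff ℝ (⊤ : ℕ∞) (Function.uncurry φ))
    (e : EuclideanSpace ℝ (Fin n)) (ι : EuclideanSpace ℝ (Fin n) → EuclideanSpace ℝ (Fin n))
    (hι : ContDiff ℝ (⊤ : ℕ∞) ι)
    (hassoc : ∀ a b c, φ (φ a b) c = φ a (φ b c))
    (hre : ∀ a, φ a e = a) (hle : ∀ a, φ e a = a)
    (hinvr : ∀ a, φ a (ι a) = e) (hinvl : ∀ a, φ (ι a) a = e)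
    (ψr : EuclideanSpace ℝ (Fin n) →
      (EuclideanSpace ℝ (Fin n) →L[ℝ] EuclideanSpace ℝ (Fin n)))
    (hψr : ∀ a, ψr a = fderiv ℝ (fun x => φ a x) e)
    (ψl : EuclideanSpace ℝ (Fin n) →
      (EuclideanSpace ℝ (Fin n) →L[ℝ] EuclideanSpace ℝ (Fin n)))
    (hψl : ∀ a, ψl a = fderiv ℝ (fun x => φ x a) e)
    (hunitr : ∀ a, IsUnit (ψr a)) (hunitl : ∀ a, IsUnit (ψl a)) :
    ∀ u v : EuclideanSpace ℝ (Fin n),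
      VectorField.lieBracket ℝ (fun x => ψr x u) (fun x => ψr x v) e
        = - VectorField.lieBracket ℝ (fun x => ψl x u) (fun x => ψl x v) e := by
  have hd : Differentiable ℝ (Function.uncurry φ) := hφ.differentiable (by simp)
  have hd' : Differentiable ℝ (fderiv ℝ (Function.uncurry φ)) :=
    (hφ.fderiv_right (m := (⊤ : ℕ∞)) (by simp)).differentiable (by simp)
  have hsymm : IsSymmSndFDerivAt ℝ (Function.uncurry φ) (e, e) :=
    hφ.contDiffAt.isSymmSndFDerivAt (by
      rw [minSmoothness_of_isRCLikeNormedField]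
      exact WithTop.coe_le_coe.2 le_top)
  have hr : ∀ a v, ψr a v = fderiv ℝ (Function.uncurry φ) (a, e) (0, v) := fun a v => by
    rw [hψr]
    exact fderiv_comp_prodMk_right_apply (hd _) v
  have hl : ∀ a v, ψl a v = fderiv ℝ (Function.uncurry φ) (e, a) (v, 0) := fun a v => by
    rw [hψl]
    exact fderiv_comp_prodMk_left_apply (hd _) v
  have hr' : ∀ u v, fderiv ℝ (fun x => ψr x v) e u
      = fderiv ℝ (fderiv ℝ (Function.uncurry φ)) (e, e) (u, 0) (0, v) := fun u v => by
    simp_rw [hr]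
    rw [fderiv_comp_prodMk_left_apply
      (f := fun p => fderiv ℝ (Function.uncurry φ) p (0, v)) (by fun_prop),
      fderiv_clm_apply (hd' _) (by fun_prop)]
    simp
  have hl' : ∀ u v, fderiv ℝ (fun x => ψl x v) e u
      = fderiv ℝ (fderiv ℝ (Function.uncurry φ)) (e, e) (0, u) (v, 0) := fun u v => by
    simp_rw [hl]
    rw [fderiv_comp_prodMk_right_apply
      (f := fun p => fderiv ℝ (Function.uncurry φ) p (v, 0)) (by fun_prop),
      fderiv_clm_apply (hd' _) (by fun_prop)]
    simp
  have hre' : ∀ v, ψr e v = v := fun v => by simp [hψr, hle]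
  have hle' : ∀ v, ψl e v = v := fun v => by simp [hψl, hre]
  intro u v
  simp only [VectorField.lieBracket, hre', hle', hr', hl']
  rw [hsymm.eq (0, u) (v, 0), hsymm.eq (0, v) (u, 0), neg_sub]
end

section
/- The infinitesimal generators obtained from the left and right basic operators agree after transposition of their two arguments: for all u, v in ℝⁿ, (fderiv ℝ (fun x => ψ_l x) e u) v = (fderiv ℝ (fun x => ψ_r x) e v) u. -/
section MixedPartials

variable {E F G : Type*} [NormedAddCommGroup E] [NormedSpace ℝ E]
  [NormedAddCommGroup F] [NormedSpace ℝ F] [NormedAddCommGroup G] [NormedSpace ℝ G]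

theorem fderiv_fderiv_snd_apply {f : E × F → G} (hf : ContDiff ℝ 2 f) (a u : E) (b v : F) :
    fderiv ℝ (fun x => fderiv ℝ (fun y => f (x, y)) b) a u v =
      fderiv ℝ (fderiv ℝ f) (a, b) (u, 0) (0, v) := by
  have hd : Differentiable ℝ f := hf.differentiable (by norm_num)
  have hd' : Differentiable ℝ (fderiv ℝ f) :=
    (hf.fderiv_right (m := 1) (by norm_num)).differentiable (by norm_num)
  have hpartial : (fun x => fderiv ℝ (fun y => f (x, y)) b) =
      fun x => (fderiv ℝ f (x, b)).comp (ContinuousLinearMap.inr ℝ E F) := by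
    funext x
    exact ((hd (x, b)).hasFDerivAt.comp b (hasFDerivAt_prodMk_right x b)).fderiv
  have hmixed : HasFDerivAt (fun x => fderiv ℝ f (x, b))
      ((fderiv ℝ (fderiv ℝ f) (a, b)).comp (ContinuousLinearMap.inl ℝ E F)) a :=
    (hd' (a, b)).hasFDerivAt.comp a (hasFDerivAt_prodMk_left a b)
  rw [hpartial, (hmixed.clm_comp
    (hasFDerivAt_const (ContinuousLinearMap.inr ℝ E F) a)).fderiv]
  simp

theorem fderiv_fderiv_fst_apply {f : E × F → G} (hf : ContDiff ℝ 2 f) (a u : E) (b v : F) :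
    fderiv ℝ (fun y => fderiv ℝ (fun x => f (x, y)) a) b v u =
      fderiv ℝ (fderiv ℝ f) (a, b) (0, v) (u, 0) := by
  have hd : Differentiable ℝ f := hf.differentiable (by norm_num)
  have hd' : Differentiable ℝ (fderiv ℝ f) :=
    (hf.fderiv_right (m := 1) (by norm_num)).differentiable (by norm_num)
  have hpartial : (fun y => fderiv ℝ (fun x => f (x, y)) a) =
      fun y => (fderiv ℝ f (a, y)).comp (ContinuousLinearMap.inl ℝ E F) := by
    funext y
    exact ((hd (a, y)).hasFDerivAt.comp a (hasFDerivAt_prodMk_left a y)).fderiv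
  have hmixed : HasFDerivAt (fun y => fderiv ℝ f (a, y))
      ((fderiv ℝ (fderiv ℝ f) (a, b)).comp (ContinuousLinearMap.inr ℝ E F)) b :=
    (hd' (a, b)).hasFDerivAt.comp b (hasFDerivAt_prodMk_right a b)
  rw [hpartial, (hmixed.clm_comp
    (hasFDerivAt_const (ContinuousLinearMap.inl ℝ E F) b)).fderiv]
  simp

theorem fderiv_fderiv_fst_eq_fderiv_fderiv_snd {f : E × F → G} (hf : ContDiff ℝ 2 f)
    (a u : E) (b v : F) :
    fderiv ℝ (fun y => fderiv ℝ (fun x => f (x, y)) a) b v u =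
      fderiv ℝ (fun x => fderiv ℝ (fun y => f (x, y)) b) a u v := by
  rw [fderiv_fderiv_fst_apply hf, fderiv_fderiv_snd_apply hf]
  exact hf.contDiffAt.isSymmSndFDerivAt (by simp) _ _

end MixedPartials

/-- The infinitesimal generators obtained from the left and right basic operators agree after
transposition of their two arguments. -/
theorem left_right_infinitesimal_generators_transposed {n : ℕ}
    (φ : EuclideanSpace ℝ (Fin n) → EuclideanSpace ℝ (Fin n) → EuclideanSpace ℝ (Fin n))
    (hφ : ContDiff ℝ (⊤ : ℕ∞) (Function.uncurry φ))
    (e : EuclideanSpace ℝ (Fin n)) (ι : EuclideanSpace ℝ (Fin n) → EuclideanSpace ℝ (Fin n))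
    (hι : ContDiff ℝ (⊤ : ℕ∞) ι)
    (hassoc : ∀ a b c, φ (φ a b) c = φ a (φ b c))
    (hre : ∀ a, φ a e = a) (hle : ∀ a, φ e a = a)
    (hinvr : ∀ a, φ a (ι a) = e) (hinvl : ∀ a, φ (ι a) a = e)
    (ψr : EuclideanSpace ℝ (Fin n) →
      (EuclideanSpace ℝ (Fin n) →L[ℝ] EuclideanSpace ℝ (Fin n)))
    (hψr : ∀ a, ψr a = fderiv ℝ (fun x => φ a x) e)
    (ψl : EuclideanSpace ℝ (Fin n) →
      (EuclideanSpace ℝ (Fin n) →L[ℝ] EuclideanSpace ℝ (Fin n)))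
    (hψl : ∀ a, ψl a = fderiv ℝ (fun x => φ x a) e) :
    ∀ u v : EuclideanSpace ℝ (Fin n),
      (fderiv ℝ (fun x => ψl x) e u) v = (fderiv ℝ (fun x => ψr x) e v) u := by
  intro u v
  simp only [hψl, hψr]
  exact fderiv_fderiv_fst_eq_fderiv_fderiv_snd (f := Function.uncurry φ)
    (hφ.of_le (WithTop.coe_le_coe.2 (le_top : (2 : ℕ∞) ≤ ⊤))) e v e u
end

section
/- The infinitesimal generators of a linear representation satisfy the commutation relations governed by the structure constants: for all u, w in ℝⁿ, (I u).comp (I w) - (I w).comp (I u) = I (VectorField.lieBracket ℝ (fun x => ψ_l x w) (fun x => ψ_l x u) e). -/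
/-- A multiplicative map intertwines
the fields generating left translations with left composition by its derivative at `e`. -/
theorem fderiv_apply_fderiv_mul_left {E V : Type*} [NormedAddCommGroup E] [NormedSpace ℝ E]
    [NormedAddCommGroup V] [NormedSpace ℝ V] {φ : E → E → E} {e : E} {f : E → (V →L[ℝ] V)}
    (hle : ∀ a, φ e a = a) (hfmul : ∀ a b, f (φ b a) = (f b).comp (f a)) {x : E}
    (hφ : DifferentiableAt ℝ (fun y => φ y x) e) (hf : Differentiable ℝ f) (u : E) :
    fderiv ℝ f x (fderiv ℝ (fun y => φ y x) e u) = (fderiv ℝ f e u).comp (f x) := by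
  have hx : HasFDerivAt f (fderiv ℝ f x) (φ e x) := by
    rw [hle]
    exact (hf x).hasFDerivAt
  have h₁ := hx.comp e hφ.hasFDerivAt
  have h₂ := (hf e).hasFDerivAt.clm_comp (hasFDerivAt_const (f x) e)
  have h₃ : f ∘ (fun y => φ y x) = fun y => (f y).comp (f x) := funext fun y => hfmul x y
  rw [h₃] at h₁
  simpa using congrArg (fun L => L u) (h₁.unique h₂)

/-- The derivative at a point `x` of the identity `Df(y)(X y) = A ∘ f y`. -/
theorem fderiv_fderiv_apply_add {E V : Type*} [NormedAddCommGroup E] [NormedSpace ℝ E]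
    [NormedAddCommGroup V] [NormedSpace ℝ V] {f : E → (V →L[ℝ] V)} {X : E → E} {A : V →L[ℝ] V}
    {x : E} (hf : DifferentiableAt ℝ f x) (hf' : DifferentiableAt ℝ (fderiv ℝ f) x)
    (hX : DifferentiableAt ℝ X x) (h : ∀ y, fderiv ℝ f y (X y) = A.comp (f y)) (w : E) :
    fderiv ℝ (fderiv ℝ f) x w (X x) + fderiv ℝ f x (fderiv ℝ X x w)
      = A.comp (fderiv ℝ f x w) := by
  have h₁ := hf'.hasFDerivAt.clm_apply hX.hasFDerivAt
  have h₂ := (hasFDerivAt_const A x).clm_comp hf.hasFDerivAt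
  rw [funext h] at h₁
  simpa [add_comm] using congrArg (fun L => L w) (h₁.unique h₂)


/-- The infinitesimal generators of a linear representation satisfy the commutation relations
governed by the structure constants of the group. -/
theorem infinitesimal_generators_commutation_relations {n : ℕ}
    (φ : EuclideanSpace ℝ (Fin n) → EuclideanSpace ℝ (Fin n) → EuclideanSpace ℝ (Fin n))
    (hφ : ContDiff ℝ (⊤ : ℕ∞) (Function.uncurry φ))
    (e : EuclideanSpace ℝ (Fin n)) (ι : EuclideanSpace ℝ (Fin n) → EuclideanSpace ℝ (Fin n))
    (hι : ContDiff ℝ (⊤ : ℕ∞) ι)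
    (hassoc : ∀ a b c, φ (φ a b) c = φ a (φ b c))
    (hre : ∀ a, φ a e = a) (hle : ∀ a, φ e a = a)
    (hinvr : ∀ a, φ a (ι a) = e) (hinvl : ∀ a, φ (ι a) a = e)
    (ψl : EuclideanSpace ℝ (Fin n) →
      (EuclideanSpace ℝ (Fin n) →L[ℝ] EuclideanSpace ℝ (Fin n)))
    (hψl : ∀ a, ψl a = fderiv ℝ (fun x => φ x a) e)
    {V : Type*} [NormedAddCommGroup V] [NormedSpace ℝ V] [FiniteDimensional ℝ V]
    (f : EuclideanSpace ℝ (Fin n) → (V →L[ℝ] V))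
    (hf : ContDiff ℝ (⊤ : ℕ∞) f)
    (hfe : f e = ContinuousLinearMap.id ℝ V)
    (hfmul : ∀ a b, f (φ b a) = (f b).comp (f a))
    (I : EuclideanSpace ℝ (Fin n) →L[ℝ] (V →L[ℝ] V))
    (hI : I = fderiv ℝ f e) :
    ∀ u w : EuclideanSpace ℝ (Fin n),
      (I u).comp (I w) - (I w).comp (I u)
        = I (VectorField.lieBracket ℝ (fun x => ψl x w) (fun x => ψl x u) e) := by
  intro u w
  have hφ' (x : EuclideanSpace ℝ (Fin n)) : Differentiable ℝ (fun y => φ y x) :=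
    (hφ.comp (contDiff_id.prodMk contDiff_const)).differentiable (by simp)
  have hfd : Differentiable ℝ f := hf.differentiable (by simp)
  have hfd' : Differentiable ℝ (fderiv ℝ f) :=
    (hf.fderiv_right (m := 1) (by norm_cast)).differentiable (by simp)
  have hψ : Differentiable ℝ ψl := by
    rw [funext hψl]
    have hswap : ContDiff ℝ (⊤ : ℕ∞) (Function.uncurry fun x y => φ y x) :=
      hφ.comp (contDiff_snd.prodMk contDiff_fst)
    exact (ContDiff.fderiv (n := 1) (m := (⊤ : ℕ∞)) hswap contDiff_const
      (by norm_cast)).differentiable (by simp)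
  have hX (v : EuclideanSpace ℝ (Fin n)) : DifferentiableAt ℝ (fun x => ψl x v) e :=
    (hψ e).clm_apply (differentiableAt_const v)
  have hψe (v : EuclideanSpace ℝ (Fin n)) : ψl e v = v := by
    rw [hψl, funext hre, fderiv_fun_id, ContinuousLinearMap.id_apply]
  have hfX (v x : EuclideanSpace ℝ (Fin n)) : fderiv ℝ f x (ψl x v) = (I v).comp (f x) := by
    rw [hψl, hI]
    exact fderiv_apply_fderiv_mul_left hle hfmul (hφ' x e) hfd v
  have hu := fderiv_fderiv_apply_add (hfd e) (hfd' e) (hX u) (hfX u) w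
  have hw := fderiv_fderiv_apply_add (hfd e) (hfd' e) (hX w) (hfX w) u
  have hsymm : fderiv ℝ (fderiv ℝ f) e w u = fderiv ℝ (fderiv ℝ f) e u w :=
    (hf.contDiffAt.isSymmSndFDerivAt (by simp; norm_cast)).eq w u
  rw [← hI, hψe] at hu hw
  rw [← hu, ← hw, hsymm, VectorField.lieBracket, map_sub, hψe, hψe]
  abel
end

section
/- The infinitesimal generator of the conjugated (dual) representation is the negative of the original one: for every v in V, every continuous linear functional u : V →L[ℝ] ℝ, and every w in ℝⁿ, fderiv ℝ (fun a => u (f (ι a) v)) e w = - u ((I w) v). -/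
/-- If `g` is a pointwise left inverse of `f` and both are the identity at `x`, then the derivatives
of `g` and `f` at `x` are opposite. -/
theorem HasFDerivAt.eq_neg_of_comp_eq_id {E V : Type*} [NormedAddCommGroup E] [NormedSpace ℝ E]
    [NormedAddCommGroup V] [NormedSpace ℝ V] {f g : E → (V →L[ℝ] V)} {f' g' : E →L[ℝ] (V →L[ℝ] V)}
    {x : E} (hf : HasFDerivAt f f' x) (hg : HasFDerivAt g g' x)
    (hfx : f x = ContinuousLinearMap.id ℝ V) (hgx : g x = ContinuousLinearMap.id ℝ V)
    (h : ∀ a, (g a).comp (f a) = ContinuousLinearMap.id ℝ V) : g' = -f' := by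
  have hcomp := hg.clm_comp hf
  simp only [h] at hcomp
  have hzero := hcomp.unique (hasFDerivAt_const _ x)
  ext w v
  have hwv := DFunLike.congr_fun (DFunLike.congr_fun hzero w) v
  simp only [hfx, hgx, add_apply, ContinuousLinearMap.comp_apply,
    ContinuousLinearMap.compL_apply, ContinuousLinearMap.flip_apply, ContinuousLinearMap.id_apply,
    zero_apply] at hwv
  exact eq_neg_of_add_eq_zero_right hwv

/-- The infinitesimal generator of the conjugated (dual) representation is the negative of the
infinitesimal generator of the original representation. -/
theorem conjugated_representation_generator_neg {n : ℕ}
    (φ : EuclideanSpace ℝ (Fin n) → EuclideanSpace ℝ (Fin n) → EuclideanSpace ℝ (Fin n))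
    (hφ : ContDiff ℝ (⊤ : ℕ∞) (Function.uncurry φ))
    (e : EuclideanSpace ℝ (Fin n)) (ι : EuclideanSpace ℝ (Fin n) → EuclideanSpace ℝ (Fin n))
    (hι : ContDiff ℝ (⊤ : ℕ∞) ι)
    (hassoc : ∀ a b c, φ (φ a b) c = φ a (φ b c))
    (hre : ∀ a, φ a e = a) (hle : ∀ a, φ e a = a)
    (hinvr : ∀ a, φ a (ι a) = e) (hinvl : ∀ a, φ (ι a) a = e)
    {V : Type*} [NormedAddCommGroup V] [NormedSpace ℝ V] [FiniteDimensional ℝ V]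
    (f : EuclideanSpace ℝ (Fin n) → (V →L[ℝ] V))
    (hf : ContDiff ℝ (⊤ : ℕ∞) f)
    (hfe : f e = ContinuousLinearMap.id ℝ V)
    (hfmul : ∀ a b, f (φ b a) = (f b).comp (f a))
    (I : EuclideanSpace ℝ (Fin n) →L[ℝ] (V →L[ℝ] V))
    (hI : I = fderiv ℝ f e) :
    ∀ (v : V) (u : V →L[ℝ] ℝ) (w : EuclideanSpace ℝ (Fin n)),
      fderiv ℝ (fun a => u (f (ι a) v)) e w = - u ((I w) v) := by
  intro v u w
  have hιe : ι e = e := (hle (ι e)).symm.trans (hinvr e)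
  have hfd : HasFDerivAt f (fderiv ℝ f e) e := (hf.differentiable (by simp) e).hasFDerivAt
  have hgd : HasFDerivAt (fun a => f (ι a)) (fderiv ℝ (fun a => f (ι a)) e) e :=
    ((hf.comp hι).differentiable (by simp) e).hasFDerivAt
  have hneg := hfd.eq_neg_of_comp_eq_id hgd hfe (by simp only [hιe, hfe])
    fun a => by rw [← hfmul, hinvl, hfe]
  have hu := u.hasFDerivAt.comp e (hgd.clm_apply (hasFDerivAt_const v e))
  rw [show (fun a => u (f (ι a) v)) = u ∘ fun a => f (ι a) v from rfl, hu.fderiv, hneg, hI]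
  simp
end

section
/- A completely integrable system of first-order partial differential equations has local solutions with arbitrarily prescribed initial value: let Ψ : ℝᵐ × ℝⁿ → (ℝⁿ →L[ℝ] ℝᵐ) be C^∞ and satisfy the integrability condition that for every p = (θ, x) and all u, v in ℝⁿ, (fderiv ℝ Ψ p (Ψ p u, u)) v = (fderiv ℝ Ψ p (Ψ p v, v)) u. Then for every θ₀ in ℝᵐ and x₀ in ℝⁿ there exist ε > 0 and a function θ : ℝⁿ → ℝᵐ with θ x₀ = θ₀ such that for every x in the open ball of radius ε around x₀, θ has Fréchet derivative Ψ (θ x, x) at x (HasFDerivAt θ (Ψ (θ x, x)) x). -/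
open Set Metric Filter Topology
open scoped NNReal

section LocalSolutions

variable {E F G : Type*} [NormedAddCommGroup E] [NormedSpace ℝ E]
  [NormedAddCommGroup F] [NormedSpace ℝ F] [NormedAddCommGroup G] [NormedSpace ℝ G]

/-- The Picard-Lindelöf theorem, recording that the solution stays in the closed ball on which the
vector field is controlled. -/
theorem IsPicardLindelof.exists_hasDerivWithinAt_mem_closedBall [CompleteSpace E]
    {f : ℝ → E → E} {tmin tmax : ℝ} {t₀ : Icc tmin tmax} {x₀ x : E} {a r L K : ℝ≥0}
    (hf : IsPicardLindelof f t₀ x₀ a r L K) (hx : x ∈ closedBall x₀ r) :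
    ∃ α : ℝ → E, α t₀ = x ∧ ∀ t ∈ Icc tmin tmax,
      α t ∈ closedBall x₀ a ∧ HasDerivWithinAt α (f t (α t)) (Icc tmin tmax) t := by
  obtain ⟨α, hα⟩ := ODE.FunSpace.exists_isFixedPt_next hf hx
  have key : ∀ t ∈ Icc tmin tmax, α.compProj t = ODE.picard f t₀ x α.compProj t := by
    intro t ht
    rw [ODE.FunSpace.compProj_of_mem ht]
    exact (ODE.FunSpace.isFixedPt_next_iff hf hx).1 hα ⟨t, ht⟩
  refine ⟨α.compProj, by rw [key _ t₀.2, ODE.picard_apply₀], fun t ht ↦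
    ⟨α.compProj_mem_closedBall hf.mul_max_le, ?_⟩⟩
  exact (ODE.hasDerivWithinAt_picard_Icc t₀.2 hf.continuousOn_uncurry
    α.continuous_compProj.continuousOn
    (fun _ _ ↦ α.compProj_mem_closedBall hf.mul_max_le) x ht).congr key (key t ht)

/-- A `C²` function, its derivative, and the Lipschitz constant of its derivative are bounded near
any point. -/
theorem ContDiff.exists_closedBall_norm_le {f : E → G} (hf : ContDiff ℝ 2 f) (p : E) :
    ∃ R > 0, ∃ C : ℝ≥0, 1 ≤ C ∧ (∀ q ∈ closedBall p R, ‖f q‖ ≤ C) ∧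
      (∀ q ∈ closedBall p R, ‖fderiv ℝ f q‖ ≤ C) ∧
      LipschitzOnWith C (fderiv ℝ f) (closedBall p R) := by
  have hf' : ContDiff ℝ 1 (fderiv ℝ f) := hf.fderiv_right (by norm_num)
  obtain ⟨K, s, hs, hK⟩ := hf'.contDiffAt.exists_lipschitzOnWith (x := p)
  have h₁ : ∀ᶠ q in 𝓝 p, ‖f q‖ < ‖f p‖ + 1 :=
    hf.continuous.norm.continuousAt.eventually_lt continuousAt_const (by simp)
  have h₂ : ∀ᶠ q in 𝓝 p, ‖fderiv ℝ f q‖ < ‖fderiv ℝ f p‖ + 1 :=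
    hf'.continuous.norm.continuousAt.eventually_lt continuousAt_const (by simp)
  obtain ⟨R, hR, hball⟩ := nhds_basis_closedBall.mem_iff.1 (inter_mem hs (h₁.and h₂))
  refine ⟨R, hR, 1 + ‖f p‖₊ + ‖fderiv ℝ f p‖₊ + K, ?_, fun q hq ↦ ?_, fun q hq ↦ ?_, ?_⟩
  · rw [add_assoc, add_assoc]
    exact le_self_add
  · have := (hball hq).2.1
    push_cast
    linarith [norm_nonneg (fderiv ℝ f p), K.coe_nonneg]
  · have := (hball hq).2.2
    push_cast
    linarith [norm_nonneg (f p), K.coe_nonneg]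
  · exact (hK.mono fun q hq ↦ (hball hq).1).weaken le_add_self

/-- Restricting `∂θ/∂x = Ψ (θ, x)` to the segment from `x₀` to `x₀ + w` gives an ordinary
differential equation, which has a solution for small `w`. -/
theorem exists_solution_along_segment [CompleteSpace F] {Ψ : F × E → (E →L[ℝ] F)}
    (hΨ : Differentiable ℝ Ψ) {θ₀ : F} {x₀ : E} {R : ℝ} {C : ℝ≥0} (hC : 1 ≤ C)
    (h₀ : ∀ q ∈ closedBall (θ₀, x₀) R, ‖Ψ q‖ ≤ C)
    (h₁ : ∀ q ∈ closedBall (θ₀, x₀) R, ‖fderiv ℝ Ψ q‖ ≤ C) {w : E} (hw : C * ‖w‖ ≤ R) :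
    ∃ y : ℝ → F, y 0 = θ₀ ∧ ∀ t ∈ Icc (0 : ℝ) 1, ‖y t - θ₀‖ ≤ C * ‖w‖ ∧
      HasDerivWithinAt y (Ψ (y t, x₀ + t • w) w) (Icc 0 1) t := by
  have hwR : ‖w‖ ≤ R := by
    have : (1 : ℝ) ≤ C := hC
    nlinarith [norm_nonneg w]
  have hmem : ∀ t ∈ Icc (0 : ℝ) 1, ∀ y ∈ closedBall θ₀ (C * ‖w‖),
      (y, x₀ + t • w) ∈ closedBall (θ₀, x₀) R := by
    intro t ht y hy
    rw [← closedBall_prod_same]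
    refine ⟨closedBall_subset_closedBall hw hy, ?_⟩
    rw [mem_closedBall_iff_norm, add_sub_cancel_left, norm_smul, Real.norm_of_nonneg ht.1]
    nlinarith [ht.2, norm_nonneg w]
  have hlip : LipschitzOnWith C Ψ (closedBall (θ₀, x₀) R) :=
    (convex_closedBall _ _).lipschitzOnWith_of_nnnorm_fderiv_le (fun q _ ↦ hΨ q) h₁
  have hPL : IsPicardLindelof (fun t y ↦ Ψ (y, x₀ + t • w) w)
      (⟨0, by simp⟩ : Icc (0 : ℝ) 1) θ₀ (C * ‖w‖₊) 0 (C * ‖w‖₊) (C * ‖w‖₊) := by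
    refine ⟨fun t ht ↦ ?_, fun y _ ↦ ?_, fun t ht y hy ↦ ?_, by simp⟩
    · refine LipschitzOnWith.of_dist_le_mul fun y hy y' hy' ↦ ?_
      have := hlip.dist_le_mul _ (hmem t ht y hy) _ (hmem t ht y' hy')
      rw [dist_eq_norm, ← sub_apply]
      refine (ContinuousLinearMap.le_opNorm _ _).trans ?_
      rw [← dist_eq_norm]
      rw [Prod.dist_eq, dist_self, max_eq_left dist_nonneg] at this
      push_cast
      nlinarith [norm_nonneg w]
    · have := hΨ.continuous
      fun_prop
    · refine (ContinuousLinearMap.le_opNorm _ _).trans ?_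
      push_cast
      gcongr
      exact h₀ _ (hmem t ht y hy)
  obtain ⟨y, hy0, hy⟩ := hPL.exists_hasDerivWithinAt_mem_closedBall (x := θ₀) (by simp)
  refine ⟨y, hy0, fun t ht ↦ ⟨?_, (hy t ht).2⟩⟩
  simpa [dist_eq_norm] using (hy t ht).1

/-- For a completely integrable system, the solution along the segment to `x₀ + (w + h)` agrees at
its endpoint to first order in `h` with the solution `y` along the segment to `x₀ + w`, corrected by
`Ψ h`: the curve `t ↦ y t + t • Ψ (y t, x₀ + t • w) h` is an approximate solution. -/
theorem norm_solution_along_segment_sub_le {Ψ : F × E → (E →L[ℝ] F)}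
    (hΨ : Differentiable ℝ Ψ)
    (hint : ∀ (p : F × E) (u v : E),
      (fderiv ℝ Ψ p (Ψ p u, u)) v = (fderiv ℝ Ψ p (Ψ p v, v)) u)
    {θ₀ : F} {x₀ : E} {R : ℝ} {C : ℝ≥0} (hC : 1 ≤ C)
    (h₀ : ∀ q ∈ closedBall (θ₀, x₀) R, ‖Ψ q‖ ≤ C)
    (h₁ : ∀ q ∈ closedBall (θ₀, x₀) R, ‖fderiv ℝ Ψ q‖ ≤ C)
    (h₂ : LipschitzOnWith C (fderiv ℝ Ψ) (closedBall (θ₀, x₀) R))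
    {w h : E} (hwh : C * ‖w‖ + C * ‖h‖ ≤ R) {y y' : ℝ → F} (hy0 : y 0 = θ₀) (hy'0 : y' 0 = θ₀)
    (hy : ∀ t ∈ Icc (0 : ℝ) 1, ‖y t - θ₀‖ ≤ C * ‖w‖ ∧
      HasDerivWithinAt y (Ψ (y t, x₀ + t • w) w) (Icc 0 1) t)
    (hy' : ∀ t ∈ Icc (0 : ℝ) 1, ‖y' t - θ₀‖ ≤ C * ‖w + h‖ ∧
      HasDerivWithinAt y' (Ψ (y' t, x₀ + t • (w + h)) (w + h)) (Icc 0 1) t) :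
    ‖y' 1 - y 1 - Ψ (y 1, x₀ + w) h‖ ≤
      gronwallBound 0 (C * R) ((C ^ 2 + C ^ 3 * R) * ‖h‖ ^ 2) 1 := by
  have hC1 : (1 : ℝ) ≤ C := hC
  have hw0 := norm_nonneg w
  have hh0 := norm_nonneg h
  have hwhn : C * ‖w + h‖ ≤ R :=
    (mul_le_mul_of_nonneg_left (norm_add_le w h) C.coe_nonneg).trans (by linarith)
  have hwhR : ‖w + h‖ ≤ R := by nlinarith [norm_nonneg (w + h)]
  have hwR : ‖w‖ ≤ R := by nlinarith
  have hR : 0 ≤ R := hw0.trans hwR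
  have hseg : ∀ t ∈ Icc (0 : ℝ) 1, ∀ v : E, ‖v‖ ≤ R → x₀ + t • v ∈ closedBall x₀ R := by
    intro t ht v hv
    rw [mem_closedBall_iff_norm, add_sub_cancel_left, norm_smul, Real.norm_of_nonneg ht.1]
    nlinarith [ht.2, norm_nonneg v]
  have hlip : LipschitzOnWith C Ψ (closedBall (θ₀, x₀) R) :=
    (convex_closedBall _ _).lipschitzOnWith_of_nnnorm_fderiv_le (fun q _ ↦ hΨ q) h₁
  have hp : ∀ t ∈ Icc (0 : ℝ) 1, (y t, x₀ + t • w) ∈ closedBall (θ₀, x₀) R := by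
    intro t ht
    rw [← closedBall_prod_same]
    refine ⟨?_, hseg t ht w hwR⟩
    rw [mem_closedBall_iff_norm]
    exact (hy t ht).1.trans (by nlinarith)
  set z : ℝ → F := fun t ↦ y t + t • Ψ (y t, x₀ + t • w) h with hz
  have hzmem : ∀ t ∈ Icc (0 : ℝ) 1, z t ∈ closedBall θ₀ R := by
    intro t ht
    have h1 : ‖t • Ψ (y t, x₀ + t • w) h‖ ≤ C * ‖h‖ := by
      rw [norm_smul, Real.norm_of_nonneg ht.1]
      have := (Ψ (y t, x₀ + t • w)).le_of_opNorm_le (h₀ _ (hp t ht)) h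
      nlinarith [ht.1, ht.2, norm_nonneg (Ψ (y t, x₀ + t • w) h)]
    rw [mem_closedBall_iff_norm, hz, add_sub_right_comm]
    exact (norm_add_le _ _).trans ((add_le_add (hy t ht).1 h1).trans hwh)
  set z' : ℝ → F := fun t ↦ Ψ (y t, x₀ + t • w) w + (Ψ (y t, x₀ + t • w) h +
    t • (fderiv ℝ Ψ (y t, x₀ + t • w) (Ψ (y t, x₀ + t • w) w, w)) h) with hz'
  have hzder : ∀ t ∈ Icc (0 : ℝ) 1, HasDerivWithinAt z (z' t) (Icc 0 1) t := by
    intro t ht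
    have hseg' : HasDerivWithinAt (fun t : ℝ ↦ x₀ + t • w) w (Icc 0 1) t := by
      simpa using (((hasDerivAt_id t).smul_const w).const_add x₀).hasDerivWithinAt
    have hcomp := (hΨ (y t, x₀ + t • w)).hasFDerivAt.comp_hasDerivWithinAt t
      ((hy t ht).2.prodMk hseg')
    have happ := hcomp.clm_apply (hasDerivWithinAt_const t (Icc (0 : ℝ) 1) h)
    have hsm := (hasDerivWithinAt_id t (Icc (0 : ℝ) 1)).fun_smul happ
    refine ((hy t ht).2.fun_add hsm).congr_deriv ?_
    simp [hz', add_comm]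
  have hzerr : ∀ t ∈ Icc (0 : ℝ) 1, ‖z' t - Ψ (z t, x₀ + t • (w + h)) (w + h)‖ ≤
      (C ^ 2 + C ^ 3 * R) * ‖h‖ ^ 2 := by
    intro t ht
    set p : F × E := (y t, x₀ + t • w) with hpdef
    set q : F × E := (z t, x₀ + t • (w + h)) with hqdef
    have hq : q ∈ closedBall (θ₀, x₀) R := by
      rw [← closedBall_prod_same]
      exact ⟨hzmem t ht, hseg t ht _ hwhR⟩
    have hqp : q - p = t • (Ψ p h, h) := by
      simp [hqdef, hpdef, hz]
    have hΨh : ‖Ψ p h‖ ≤ C * ‖h‖ := (Ψ p).le_of_opNorm_le (h₀ _ (hp t ht)) h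
    have hqpn : ‖q - p‖ ≤ C * ‖h‖ := by
      rw [hqp, norm_smul, Real.norm_of_nonneg ht.1]
      have : ‖(Ψ p h, h)‖ ≤ C * ‖h‖ := max_le hΨh (by nlinarith)
      nlinarith [ht.1, ht.2, norm_nonneg (Ψ p h, h)]
    have hrem : ‖Ψ q - Ψ p - fderiv ℝ Ψ p (q - p)‖ ≤ C * ‖q - p‖ * ‖q - p‖ := by
      have hsub : closedBall (θ₀, x₀) R ∩ closedBall p ‖q - p‖ ⊆ closedBall (θ₀, x₀) R :=
        inter_subset_left
      refine ((convex_closedBall _ _).inter (convex_closedBall _ _)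
        ).norm_image_sub_le_of_norm_fderiv_le' (s := closedBall (θ₀, x₀) R ∩ closedBall p ‖q - p‖)
        (fun r _ ↦ hΨ r) (fun r hr ↦ ?_) ⟨hp t ht, by simp⟩ ⟨hq, by simp [dist_eq_norm]⟩
      refine (h₂.norm_sub_le hr.1 (hp t ht)).trans ?_
      gcongr
      exact mem_closedBall_iff_norm.1 hr.2
    have hsplit : z' t - Ψ q (w + h) = -(fderiv ℝ Ψ p (q - p)) h
        - (Ψ q - Ψ p - fderiv ℝ Ψ p (q - p)) (w + h) := by
      have h3 : z' t = Ψ p w + (Ψ p h + t • (fderiv ℝ Ψ p (Ψ p w, w)) h) := rfl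
      rw [h3, hint p w h, hqp]
      simp only [map_smul, map_add, sub_apply, smul_apply]
      abel
    rw [hsplit]
    have e1 : ‖(fderiv ℝ Ψ p (q - p)) h‖ ≤ C * (C * ‖h‖) * ‖h‖ := by
      refine ContinuousLinearMap.le_of_opNorm_le _ ?_ _
      refine (ContinuousLinearMap.le_of_opNorm_le _ (h₁ _ (hp t ht)) _).trans ?_
      gcongr
    have e2 : ‖(Ψ q - Ψ p - fderiv ℝ Ψ p (q - p)) (w + h)‖ ≤
        C * (C * ‖h‖) * (C * ‖h‖) * R := by
      refine (ContinuousLinearMap.le_of_opNorm_le _ hrem _).trans ?_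
      gcongr
    calc _ ≤ C * (C * ‖h‖) * ‖h‖ + C * (C * ‖h‖) * (C * ‖h‖) * R := by
          refine (norm_sub_le _ _).trans ?_
          rw [norm_neg]
          exact add_le_add e1 e2
      _ = _ := by ring
  have hIci : ∀ t ∈ Ico (0 : ℝ) 1, Icc (0 : ℝ) 1 ∈ 𝓝[Ici t] t := fun t ht ↦
    mem_of_superset (Icc_mem_nhdsGE ht.2) (Icc_subset_Icc_left ht.1)
  have hgron := dist_le_of_approx_trajectories_ODE_of_mem
    (v := fun t y ↦ Ψ (y, x₀ + t • (w + h)) (w + h)) (s := fun _ ↦ closedBall θ₀ R)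
    (K := C * R.toNNReal) (a := 0) (b := 1) (f := y') (g := z) (g' := z')
    (f' := fun t ↦ Ψ (y' t, x₀ + t • (w + h)) (w + h)) (δ := 0) (εf := 0)
    (εg := (C ^ 2 + C ^ 3 * R) * ‖h‖ ^ 2)
    (fun t ht ↦ LipschitzOnWith.of_dist_le_mul fun a ha b hb ↦ by
      have hmem : ∀ c ∈ closedBall θ₀ R, (c, x₀ + t • (w + h)) ∈ closedBall (θ₀, x₀) R := by
        intro c hc
        rw [← closedBall_prod_same]
        exact ⟨hc, hseg t (Ico_subset_Icc_self ht) _ hwhR⟩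
      have := hlip.norm_sub_le (hmem a ha) (hmem b hb)
      rw [Prod.mk_sub_mk, sub_self, Prod.norm_mk, norm_zero,
        max_eq_left (norm_nonneg _)] at this
      rw [dist_eq_norm, dist_eq_norm, ← sub_apply]
      refine (ContinuousLinearMap.le_of_opNorm_le _ this _).trans ?_
      rw [NNReal.coe_mul, Real.coe_toNNReal R hR, mul_right_comm]
      gcongr)
    (fun t ht ↦ (hy' t ht).2.continuousWithinAt)
    (fun t ht ↦ (hy' t (Ico_subset_Icc_self ht)).2.mono_of_mem_nhdsWithin (hIci t ht))
    (fun t _ ↦ by simp)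
    (fun t ht ↦ mem_closedBall_iff_norm.2
      ((hy' t (Ico_subset_Icc_self ht)).1.trans hwhn))
    (fun t ht ↦ (hzder t ht).continuousWithinAt)
    (fun t ht ↦ (hzder t (Ico_subset_Icc_self ht)).mono_of_mem_nhdsWithin (hIci t ht))
    (fun t ht ↦ by
      rw [dist_eq_norm]
      exact hzerr t (Ico_subset_Icc_self ht))
    (fun t ht ↦ hzmem t (Ico_subset_Icc_self ht))
    (by simp [hz, hy0, hy'0]) 1 (by simp)
  simpa [dist_eq_norm, hz, sub_sub, hR] using hgron

/-- A completely integrable `C²` system `∂θ/∂x = Ψ (θ, x)` in Banach spaces has local solutions with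
arbitrarily prescribed initial value. -/
theorem exists_hasFDerivAt_of_completely_integrable [CompleteSpace F] {Ψ : F × E → (E →L[ℝ] F)}
    (hΨ : ContDiff ℝ 2 Ψ)
    (hint : ∀ (p : F × E) (u v : E),
      (fderiv ℝ Ψ p (Ψ p u, u)) v = (fderiv ℝ Ψ p (Ψ p v, v)) u) (θ₀ : F) (x₀ : E) :
    ∃ ε > 0, ∃ θ : E → F, θ x₀ = θ₀ ∧ ∀ x ∈ ball x₀ ε, HasFDerivAt θ (Ψ (θ x, x)) x := by
  have hd : Differentiable ℝ Ψ := hΨ.differentiable (by norm_num)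
  obtain ⟨R, hR, C, hC, h₀, h₁, h₂⟩ := hΨ.exists_closedBall_norm_le (θ₀, x₀)
  have hC0 : (0 : ℝ) < C := zero_lt_one.trans_le hC
  have hsol : ∀ w : E, ∃ y : ℝ → F, C * ‖w‖ ≤ R → y 0 = θ₀ ∧ ∀ t ∈ Icc (0 : ℝ) 1,
      ‖y t - θ₀‖ ≤ C * ‖w‖ ∧ HasDerivWithinAt y (Ψ (y t, x₀ + t • w) w) (Icc 0 1) t := by
    intro w
    by_cases hw : C * ‖w‖ ≤ R
    · obtain ⟨y, hy⟩ := exists_solution_along_segment hd hC h₀ h₁ hw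
      exact ⟨y, fun _ ↦ hy⟩
    · exact ⟨0, fun h ↦ absurd h hw⟩
  choose y hy using hsol
  refine ⟨R / C, by positivity, fun x ↦ y (x - x₀) 1, ?_, fun x hx ↦ ?_⟩
  · have := ((hy 0 (by simpa using hR.le)).2 1 (by simp)).1
    simpa [sub_eq_zero] using this
  have hx : C * ‖x - x₀‖ < R := by
    rwa [mem_ball_iff_norm, lt_div_iff₀' hC0] at hx
  have hsmall : ∀ᶠ x' in 𝓝 x, C * ‖x - x₀‖ + C * ‖x' - x‖ < R := by
    refine ContinuousAt.eventually_lt (by fun_prop) continuousAt_const ?_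
    simpa using hx
  have hO : (fun x' ↦ y (x' - x₀) 1 - y (x - x₀) 1 - Ψ (y (x - x₀) 1, x) (x' - x))
      =O[𝓝 x] fun x' ↦ ‖x' - x‖ ^ 2 := by
    refine Asymptotics.IsBigO.of_bound
      ((C ^ 2 + C ^ 3 * R) / (C * R) * (Real.exp (C * R) - 1)) ?_
    filter_upwards [hsmall] with x' hx'
    have hsum : x - x₀ + (x' - x) = x' - x₀ := by abel
    have hx'R : C * ‖x' - x₀‖ ≤ R := by
      rw [← hsum]
      exact (mul_le_mul_of_nonneg_left (norm_add_le _ _) C.coe_nonneg).trans (by linarith)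
    have key := norm_solution_along_segment_sub_le hd hint hC h₀ h₁ h₂ hx'.le
      (hy _ hx.le).1 (hy _ hx'R).1 (hy _ hx.le).2 (by rw [hsum]; exact (hy _ hx'R).2)
    rw [gronwallBound_of_K_ne_0 (by positivity), add_sub_cancel] at key
    refine key.trans (le_of_eq ?_)
    rw [norm_pow, norm_norm]
    ring_nf
  have hderiv := (hO.hasFDerivAt (𝕜 := ℝ) one_lt_two).add
    ((Ψ (y (x - x₀) 1, x)).hasFDerivAt.comp x ((hasFDerivAt_id x).sub_const x))
  have hderiv' := hderiv.add_const (y (x - x₀) 1)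
  refine (hderiv'.congr_fderiv (by ext; simp)).congr_of_eventuallyEq (.of_forall fun x' ↦ ?_)
  simp

end LocalSolutions

/-- A completely integrable system of first-order partial differential equations
`∂θ/∂x = Ψ (θ, x)` has local solutions with arbitrarily prescribed initial value. -/
theorem completely_integrable_system_has_local_solutions {m n : ℕ}
    (Ψ : EuclideanSpace ℝ (Fin m) × EuclideanSpace ℝ (Fin n) →
      (EuclideanSpace ℝ (Fin n) →L[ℝ] EuclideanSpace ℝ (Fin m)))
    (hΨ : ContDiff ℝ (⊤ : ℕ∞) Ψ)
    (hint : ∀ (p : EuclideanSpace ℝ (Fin m) × EuclideanSpace ℝ (Fin n))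
      (u v : EuclideanSpace ℝ (Fin n)),
      (fderiv ℝ Ψ p (Ψ p u, u)) v = (fderiv ℝ Ψ p (Ψ p v, v)) u) :
    ∀ (θ₀ : EuclideanSpace ℝ (Fin m)) (x₀ : EuclideanSpace ℝ (Fin n)),
      ∃ ε > 0, ∃ θ : EuclideanSpace ℝ (Fin n) → EuclideanSpace ℝ (Fin m),
        θ x₀ = θ₀ ∧ ∀ x ∈ Metric.ball x₀ ε, HasFDerivAt θ (Ψ (θ x, x)) x := by
  intro θ₀ x₀
  exact exists_hasFDerivAt_of_completely_integrable (contDiff_infty.1 hΨ 2) hint θ₀ x₀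
end
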